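/- Let μ be a unit pure imaginary quaternion and let f ∈ 𝒮(ℝ²,ℍ) be a Schwartz function. Then for all (u,v) ∈ ℝ², L^{μ,μ}[ (x,y) ↦ ∂²f/∂x∂y(x,y) + (a₂/b₂) y (∂f/∂x)(x,y) μ + μ (a₁/b₁) x (∂f/∂y)(x,y) + μ (a₁a₂/(b₁b₂)) x y f(x,y) μ ](u,v) = μ (uv/(b₁b₂)) L^{μ,μ}[f](u,v) μ. -/

import Mathlib

noncomputable section
open MeasureTheory Real
open scoped ENNReal

abbrev ℍ : Type := Quaternion ℝ

/-- `μ` is a unit pure imaginary quaternion: `Re μ = 0` and `μ² = −1`. -/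
def UnitPureIm (μ : ℍ) : Prop := μ.re = 0 ∧ μ ^ 2 = -1

/-- membership in the slice `ℍ(μ) = {x + μ y : x, y ∈ ℝ}`. -/
def InSlice (μ : ℍ) (q : ℍ) : Prop := ∃ x y : ℝ, q = (x : ℍ) + y • μ

/-- `exp (t μ)` for a unit pure imaginary quaternion `μ`. -/
def qexp (μ : ℍ) (t : ℝ) : ℍ := (Real.cos t : ℍ) + Real.sin t • μ

/-- `(2πbμ)^(−1/2) := (2π|b|)^(−1/2) exp(−sgn(b) μ π/4)`. -/
def invSqrtFactor (μ : ℍ) (b : ℝ) : ℍ :=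
  (Real.sqrt (2 * π * |b|))⁻¹ • qexp μ (-(Real.sign b) * (π / 4))

/-- QLCT kernel `K_B^μ(x,u)` for `B = [[a,b],[c,d]]` (the entry `c` does not occur). -/
def K (μ : ℍ) (a b d : ℝ) (x u : ℝ) : ℍ :=
  invSqrtFactor μ b * qexp μ (a * x ^ 2 / (2 * b) - x * u / b + d * u ^ 2 / (2 * b))

/-- two-sided QLCT `L^{μ,ν}_{B₁,B₂}[f]`. -/
def QLCT (μ ν : ℍ) (a₁ b₁ d₁ a₂ b₂ d₂ : ℝ) (f : ℝ × ℝ → ℍ) : ℝ × ℝ → ℍ :=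
  fun w => ∫ p : ℝ × ℝ, K μ a₁ b₁ d₁ p.1 w.1 * f p * K ν a₂ b₂ d₂ p.2 w.2

/-- weight `W_B^μ(t,τ)` for `B = [[a,b],[c,d]]`. -/
def W (μ : ℍ) (a b : ℝ) (t τ : ℝ) : ℍ :=
  invSqrtFactor μ b * qexp μ (a * τ * (τ - t) / b)

/-- spatial convolution `f ⊛^{μ,ν}_{B₁,B₂} g`. -/
def sconv (μ ν : ℍ) (a₁ b₁ a₂ b₂ : ℝ) (f g : ℝ × ℝ → ℍ) : ℝ × ℝ → ℍ :=
  fun w => ∫ τ : ℝ × ℝ,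
    W μ a₁ b₁ w.1 τ.1 * f τ * g (w.1 - τ.1, w.2 - τ.2) * W ν a₂ b₂ w.2 τ.2

open scoped LineDeriv SchwartzMap

theorem integral_hasLineDerivAt_eq_zero {E F : Type*} [NormedAddCommGroup E] [NormedSpace ℝ E]
    [MeasurableSpace E] [BorelSpace E] [FiniteDimensional ℝ E] {ν : Measure E}
    [ν.IsAddHaarMeasure] [NormedAddCommGroup F] [NormedSpace ℝ F] {f f' : E → F} {v : E}
    (hf : Integrable f ν) (hf' : Integrable f' ν) (h : ∀ x, HasLineDerivAt ℝ f (f' x) x v) :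
    ∫ x, f' x ∂ν = 0 := by
  simpa using integral_bilinear_hasLineDerivAt_right_eq_neg_left_of_integrable (μ := ν)
    (f := fun _ => (1 : ℝ)) (f' := fun _ => 0) (g := f) (g' := f') (v := v)
    (B := ContinuousLinearMap.lsmul ℝ ℝ) (by simp) (by simpa using hf') (by simpa using hf)
    (fun x _ => hasDerivAt_const (0 : ℝ) (1 : ℝ)) (fun x _ => h x)

theorem qexp_commute (μ : ℍ) (t : ℝ) : Commute (qexp μ t) μ :=
  Commute.add_left (Quaternion.coe_commutes _ _) ((Commute.refl μ).smul_left _)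

theorem K_commute (μ : ℍ) (a b d x u : ℝ) : Commute (K μ a b d x u) μ :=
  ((qexp_commute μ _).smul_left _).mul_left (qexp_commute μ _)

theorem norm_qexp_le (μ : ℍ) (t : ℝ) : ‖qexp μ t‖ ≤ 1 + ‖μ‖ := by
  refine (norm_add_le _ _).trans (add_le_add ?_ ?_)
  · simpa using Real.abs_cos_le_one t
  · rw [norm_smul]
    exact mul_le_of_le_one_left (norm_nonneg _) (Real.abs_sin_le_one t)

theorem norm_K_le (μ : ℍ) (a b d x u : ℝ) :
    ‖K μ a b d x u‖ ≤ ‖invSqrtFactor μ b‖ * (1 + ‖μ‖) :=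
  (norm_mul_le _ _).trans (mul_le_mul_of_nonneg_left (norm_qexp_le μ _) (norm_nonneg _))

theorem hasDerivAt_qexp {μ : ℍ} (hμ : UnitPureIm μ) (t : ℝ) :
    HasDerivAt (qexp μ) (qexp μ t * μ) t := by
  have hcos : HasDerivAt (fun s : ℝ => (Real.cos s • (1 : ℍ))) (-Real.sin t • (1 : ℍ)) t :=
    (Real.hasDerivAt_cos t).smul_const 1
  have hsin : HasDerivAt (fun s : ℝ => Real.sin s • μ) (Real.cos t • μ) t :=
    (Real.hasDerivAt_sin t).smul_const μ
  have hsq : μ * μ = -1 := by rw [← sq, hμ.2]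
  convert! hcos.add hsin using 1
  · funext s
    simp [qexp, ← Quaternion.coe_mul_eq_smul]
  · simp only [qexp, add_mul, smul_mul_assoc, hsq, Quaternion.coe_mul_eq_smul]
    rw [smul_neg, neg_smul, add_comm]

theorem hasDerivAt_K {μ : ℍ} (hμ : UnitPureIm μ) {a b d : ℝ} (x u : ℝ) :
    HasDerivAt (fun x => K μ a b d x u)
      (K μ a b d x u * ((a / b * x - u / b) • μ)) x := by
  have hphase : HasDerivAt
      (fun x : ℝ => a * x ^ 2 / (2 * b) - x * u / b + d * u ^ 2 / (2 * b))
      (a / b * x - u / b) x := by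
    have h := (((((hasDerivAt_id x).pow 2).const_mul a).div_const (2 * b)).sub
      (((hasDerivAt_id x).mul_const u).div_const b)).add_const (d * u ^ 2 / (2 * b))
    convert! h using 1
    simp only [id]
    by_cases hb : b = 0
    · simp [hb]
    · field_simp
      push_cast
      ring
  convert! ((hasDerivAt_qexp hμ _).scomp x hphase).const_mul (invSqrtFactor μ b) using 1
  simp [K, mul_assoc]

theorem continuous_K {μ : ℍ} (hμ : UnitPureIm μ) (a b d u : ℝ) :
    Continuous fun x => K μ a b d x u :=
  continuous_iff_continuousAt.2 fun x => (hasDerivAt_K hμ x u).continuousAt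

theorem integrable_K_mul_mul_K {μ : ℍ} (hμ : UnitPureIm μ) (a₁ b₁ d₁ a₂ b₂ d₂ : ℝ)
    (g : 𝓢(ℝ × ℝ, ℍ)) (u v : ℝ) :
    Integrable fun p : ℝ × ℝ => K μ a₁ b₁ d₁ p.1 u * g p * K μ a₂ b₂ d₂ p.2 v := by
  have h₁ : Continuous fun p : ℝ × ℝ => K μ a₁ b₁ d₁ p.1 u :=
    (continuous_K hμ a₁ b₁ d₁ u).comp continuous_fst
  have h₂ : Continuous fun p : ℝ × ℝ => K μ a₂ b₂ d₂ p.2 v :=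
    (continuous_K hμ a₂ b₂ d₂ v).comp continuous_snd
  exact (g.integrable.bdd_mul h₁.aestronglyMeasurable
    (.of_forall fun p => norm_K_le μ a₁ b₁ d₁ p.1 u)).mul_bdd h₂.aestronglyMeasurable
    (.of_forall fun p => norm_K_le μ a₂ b₂ d₂ p.2 v)

theorem QLCT_mul_left {μ : ℍ} (hμ : UnitPureIm μ) (a₁ b₁ d₁ a₂ b₂ d₂ : ℝ)
    (f : 𝓢(ℝ × ℝ, ℍ)) (w : ℝ × ℝ) :
    QLCT μ μ a₁ b₁ d₁ a₂ b₂ d₂ (fun p => μ * f p) w =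
      μ * QLCT μ μ a₁ b₁ d₁ a₂ b₂ d₂ f w := by
  simp only [QLCT]
  rw [← integral_const_mul_of_integrable (integrable_K_mul_mul_K hμ ..)]
  simp only [← mul_assoc, (K_commute μ a₁ b₁ d₁ _ _).eq]

theorem QLCT_mul_right {μ : ℍ} (hμ : UnitPureIm μ) (a₁ b₁ d₁ a₂ b₂ d₂ : ℝ)
    (f : 𝓢(ℝ × ℝ, ℍ)) (w : ℝ × ℝ) :
    QLCT μ μ a₁ b₁ d₁ a₂ b₂ d₂ (fun p => f p * μ) w =
      QLCT μ μ a₁ b₁ d₁ a₂ b₂ d₂ f w * μ := by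
  simp only [QLCT]
  rw [← integral_mul_const_of_integrable (integrable_K_mul_mul_K hμ ..)]
  simp only [mul_assoc, (K_commute μ a₂ b₂ d₂ _ _).eq]

theorem QLCT_smul (μ : ℍ) (a₁ b₁ d₁ a₂ b₂ d₂ c : ℝ) (f : ℝ × ℝ → ℍ) (w : ℝ × ℝ) :
    QLCT μ μ a₁ b₁ d₁ a₂ b₂ d₂ (fun p => c • f p) w =
      c • QLCT μ μ a₁ b₁ d₁ a₂ b₂ d₂ f w := by
  simp only [QLCT, ← integral_smul, mul_smul_comm, smul_mul_assoc]

theorem QLCT_sub {μ : ℍ} (hμ : UnitPureIm μ) (a₁ b₁ d₁ a₂ b₂ d₂ : ℝ)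
    (f g : 𝓢(ℝ × ℝ, ℍ)) (w : ℝ × ℝ) :
    QLCT μ μ a₁ b₁ d₁ a₂ b₂ d₂ (f - g) w =
      QLCT μ μ a₁ b₁ d₁ a₂ b₂ d₂ f w - QLCT μ μ a₁ b₁ d₁ a₂ b₂ d₂ g w := by
  simp only [QLCT]
  rw [← integral_sub (integrable_K_mul_mul_K hμ ..) (integrable_K_mul_mul_K hμ ..)]
  simp [mul_sub, sub_mul]

/-- The operator `g ↦ ∂g/∂x + c x μ g` on Schwartz functions. -/
def leftOp (μ : ℍ) (c : ℝ) (g : 𝓢(ℝ × ℝ, ℍ)) : 𝓢(ℝ × ℝ, ℍ) :=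
  ∂_{((1, 0) : ℝ × ℝ)} g + SchwartzMap.smulLeftCLM ℍ (fun w : ℝ × ℝ => c * w.1)
    (g.postcompCLM (ContinuousLinearMap.mul ℝ ℍ μ))

/-- The operator `g ↦ ∂g/∂y + c y g μ` on Schwartz functions. -/
def rightOp (μ : ℍ) (c : ℝ) (g : 𝓢(ℝ × ℝ, ℍ)) : 𝓢(ℝ × ℝ, ℍ) :=
  ∂_{((0, 1) : ℝ × ℝ)} g + SchwartzMap.smulLeftCLM ℍ (fun w : ℝ × ℝ => c * w.2)
    (g.postcompCLM ((ContinuousLinearMap.mul ℝ ℍ).flip μ))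

theorem leftOp_apply (μ : ℍ) (c : ℝ) (g : 𝓢(ℝ × ℝ, ℍ)) (w : ℝ × ℝ) :
    leftOp μ c g w = fderiv ℝ g w (1, 0) + (c * w.1) • (μ * g w) := by
  have h : (fun w : ℝ × ℝ => c * w.1).HasTemperateGrowth :=
    (c • ContinuousLinearMap.fst ℝ ℝ ℝ).hasTemperateGrowth
  simp [leftOp, SchwartzMap.smulLeftCLM_apply_apply h, SchwartzMap.lineDerivOp_apply_eq_fderiv]

theorem rightOp_apply (μ : ℍ) (c : ℝ) (g : 𝓢(ℝ × ℝ, ℍ)) (w : ℝ × ℝ) :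
    rightOp μ c g w = fderiv ℝ g w (0, 1) + (c * w.2) • (g w * μ) := by
  have h : (fun w : ℝ × ℝ => c * w.2).HasTemperateGrowth :=
    (c • ContinuousLinearMap.snd ℝ ℝ ℝ).hasTemperateGrowth
  simp [rightOp, SchwartzMap.smulLeftCLM_apply_apply h, SchwartzMap.lineDerivOp_apply_eq_fderiv]

theorem hasLineDerivAt_K_mul_mul_K_fst {μ : ℍ} (hμ : UnitPureIm μ) (a₁ b₁ d₁ a₂ b₂ d₂ : ℝ)
    (g : 𝓢(ℝ × ℝ, ℍ)) (u v : ℝ) (p : ℝ × ℝ) :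
    HasLineDerivAt ℝ (fun p : ℝ × ℝ => K μ a₁ b₁ d₁ p.1 u * g p * K μ a₂ b₂ d₂ p.2 v)
      (K μ a₁ b₁ d₁ p.1 u * (leftOp μ (a₁ / b₁) g p - (u / b₁) • (μ * g p)) *
        K μ a₂ b₂ d₂ p.2 v) p (1, 0) := by
  have hK : HasLineDerivAt ℝ (fun p : ℝ × ℝ => K μ a₁ b₁ d₁ p.1 u) _ p (1, 0) :=
    (HasFDerivAt.comp p (hasDerivAt_K hμ p.1 u).hasFDerivAt hasFDerivAt_fst).hasLineDerivAt (1, 0)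
  have hg := (g.differentiableAt (x := p)).hasFDerivAt.hasLineDerivAt (1, 0)
  have hK₂ : HasLineDerivAt ℝ (fun p : ℝ × ℝ => K μ a₂ b₂ d₂ p.2 v) 0 p (1, 0) := by
    simpa [HasLineDerivAt] using hasDerivAt_const (0 : ℝ) (K μ a₂ b₂ d₂ p.2 v)
  refine (HasDerivAt.mul (HasDerivAt.mul hK hg) hK₂).congr_deriv ?_
  rw [leftOp_apply]
  simp [mul_add, add_mul, mul_sub, sub_mul, sub_smul, mul_assoc]
  abel

theorem hasLineDerivAt_K_mul_mul_K_snd {μ : ℍ} (hμ : UnitPureIm μ) (a₁ b₁ d₁ a₂ b₂ d₂ : ℝ)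
    (g : 𝓢(ℝ × ℝ, ℍ)) (u v : ℝ) (p : ℝ × ℝ) :
    HasLineDerivAt ℝ (fun p : ℝ × ℝ => K μ a₁ b₁ d₁ p.1 u * g p * K μ a₂ b₂ d₂ p.2 v)
      (K μ a₁ b₁ d₁ p.1 u * (rightOp μ (a₂ / b₂) g p - (v / b₂) • (g p * μ)) *
        K μ a₂ b₂ d₂ p.2 v) p (0, 1) := by
  have hK : HasLineDerivAt ℝ (fun p : ℝ × ℝ => K μ a₂ b₂ d₂ p.2 v) _ p (0, 1) :=
    (HasFDerivAt.comp p (hasDerivAt_K hμ p.2 v).hasFDerivAt hasFDerivAt_snd).hasLineDerivAt (0, 1)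
  have hg := (g.differentiableAt (x := p)).hasFDerivAt.hasLineDerivAt (0, 1)
  have hK₁ : HasLineDerivAt ℝ (fun p : ℝ × ℝ => K μ a₁ b₁ d₁ p.1 u) 0 p (0, 1) := by
    simpa [HasLineDerivAt] using hasDerivAt_const (0 : ℝ) (K μ a₁ b₁ d₁ p.1 u)
  refine (HasDerivAt.mul (HasDerivAt.mul hK₁ hg) hK).congr_deriv ?_
  rw [rightOp_apply]
  simp only [Pi.mul_apply, zero_smul, add_zero]
  simp [mul_add, add_mul, mul_sub, sub_mul, sub_smul, mul_assoc, (K_commute μ a₂ b₂ d₂ _ _).eq]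
  abel

theorem QLCT_leftOp {μ : ℍ} (hμ : UnitPureIm μ) (a₁ b₁ d₁ a₂ b₂ d₂ : ℝ)
    (g : 𝓢(ℝ × ℝ, ℍ)) (u v : ℝ) :
    QLCT μ μ a₁ b₁ d₁ a₂ b₂ d₂ (leftOp μ (a₁ / b₁) g) (u, v) =
      (u / b₁) • (μ * QLCT μ μ a₁ b₁ d₁ a₂ b₂ d₂ g (u, v)) := by
  let h : 𝓢(ℝ × ℝ, ℍ) := (u / b₁) • g.postcompCLM (ContinuousLinearMap.mul ℝ ℍ μ)
  have hzero : QLCT μ μ a₁ b₁ d₁ a₂ b₂ d₂ (leftOp μ (a₁ / b₁) g - h) (u, v) = 0 :=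
    integral_hasLineDerivAt_eq_zero (integrable_K_mul_mul_K hμ a₁ b₁ d₁ a₂ b₂ d₂ g u v)
      (integrable_K_mul_mul_K hμ a₁ b₁ d₁ a₂ b₂ d₂ (leftOp μ (a₁ / b₁) g - h) u v)
      (hasLineDerivAt_K_mul_mul_K_fst hμ a₁ b₁ d₁ a₂ b₂ d₂ g u v)
  rw [QLCT_sub hμ, sub_eq_zero] at hzero
  rw [hzero, ← QLCT_mul_left hμ, ← QLCT_smul]
  rfl

theorem QLCT_rightOp {μ : ℍ} (hμ : UnitPureIm μ) (a₁ b₁ d₁ a₂ b₂ d₂ : ℝ)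
    (g : 𝓢(ℝ × ℝ, ℍ)) (u v : ℝ) :
    QLCT μ μ a₁ b₁ d₁ a₂ b₂ d₂ (rightOp μ (a₂ / b₂) g) (u, v) =
      (v / b₂) • (QLCT μ μ a₁ b₁ d₁ a₂ b₂ d₂ g (u, v) * μ) := by
  let h : 𝓢(ℝ × ℝ, ℍ) := (v / b₂) • g.postcompCLM ((ContinuousLinearMap.mul ℝ ℍ).flip μ)
  have hzero : QLCT μ μ a₁ b₁ d₁ a₂ b₂ d₂ (rightOp μ (a₂ / b₂) g - h) (u, v) = 0 :=
    integral_hasLineDerivAt_eq_zero (integrable_K_mul_mul_K hμ a₁ b₁ d₁ a₂ b₂ d₂ g u v)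
      (integrable_K_mul_mul_K hμ a₁ b₁ d₁ a₂ b₂ d₂ (rightOp μ (a₂ / b₂) g - h) u v)
      (hasLineDerivAt_K_mul_mul_K_snd hμ a₁ b₁ d₁ a₂ b₂ d₂ g u v)
  rw [QLCT_sub hμ, sub_eq_zero] at hzero
  rw [hzero, ← QLCT_mul_right hμ, ← QLCT_smul]
  rfl

theorem fderiv_rightOp_fst (μ : ℍ) (c : ℝ) (g : 𝓢(ℝ × ℝ, ℍ)) (w : ℝ × ℝ) :
    fderiv ℝ (rightOp μ c g) w (1, 0) =
      fderiv ℝ (fun q => fderiv ℝ g q (0, 1)) w (1, 0) +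
        (c * w.2) • (fderiv ℝ g w (1, 0) * μ) := by
  have hfun : ⇑(rightOp μ c g) =
      fun w => fderiv ℝ g w (0, 1) + (c * w.2) • (g w * μ) := funext (rightOp_apply μ c g)
  have h₁ : DifferentiableAt ℝ (fun q => fderiv ℝ g q (0, 1)) w := by
    simpa only [← SchwartzMap.lineDerivOp_apply_eq_fderiv] using
      (∂_{((0, 1) : ℝ × ℝ)} g).differentiableAt (x := w)
  have hc : HasFDerivAt (fun w : ℝ × ℝ => c * w.2) (c • ContinuousLinearMap.snd ℝ ℝ ℝ) w :=
    hasFDerivAt_snd.const_mul c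
  have hg : HasFDerivAt (fun w => g w * μ) _ w :=
    (g.differentiableAt (x := w)).hasFDerivAt.mul_const' μ
  rw [hfun, (h₁.hasFDerivAt.fun_add (hc.fun_smul hg)).fderiv]
  simp

theorem qlct_pde_lemma
    (μ : ℍ) (hμ : UnitPureIm μ)
    (a₁ b₁ c₁ d₁ a₂ b₂ c₂ d₂ : ℝ)
    (hA₁ : a₁ * d₁ - b₁ * c₁ = 1) (hA₂ : a₂ * d₂ - b₂ * c₂ = 1)
    (hb₁ : b₁ ≠ 0) (hb₂ : b₂ ≠ 0)
    (f : SchwartzMap (ℝ × ℝ) ℍ) :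
    ∀ u v : ℝ,
      QLCT μ μ a₁ b₁ d₁ a₂ b₂ d₂
        (fun w => fderiv ℝ (fun q => fderiv ℝ (⇑f) q (0, 1)) w (1, 0) +
          (a₂ / b₂ * w.2) • (fderiv ℝ (⇑f) w (1, 0) * μ) +
          (a₁ / b₁ * w.1) • (μ * fderiv ℝ (⇑f) w (0, 1)) +
          (a₁ * a₂ / (b₁ * b₂) * w.1 * w.2) • (μ * f w * μ)) (u, v) =
      (u * v / (b₁ * b₂)) • (μ * QLCT μ μ a₁ b₁ d₁ a₂ b₂ d₂ (⇑f) (u, v) * μ) := by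
  intro u v
  have hop : (fun w : ℝ × ℝ => fderiv ℝ (fun q => fderiv ℝ (⇑f) q (0, 1)) w (1, 0) +
      (a₂ / b₂ * w.2) • (fderiv ℝ (⇑f) w (1, 0) * μ) +
      (a₁ / b₁ * w.1) • (μ * fderiv ℝ (⇑f) w (0, 1)) +
      (a₁ * a₂ / (b₁ * b₂) * w.1 * w.2) • (μ * f w * μ)) =
      leftOp μ (a₁ / b₁) (rightOp μ (a₂ / b₂) f) := by
    funext w
    rw [leftOp_apply, fderiv_rightOp_fst, rightOp_apply, mul_add, smul_add, mul_smul_comm,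
      smul_smul, ← mul_assoc, ← add_assoc]
    congr 2
    · ring
    · rw [mul_assoc]
  rw [hop, QLCT_leftOp hμ, QLCT_rightOp hμ, mul_smul_comm, smul_smul, ← mul_assoc,
    div_mul_div_comm]
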